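/- Let K be an M-locally λ-generated category. Then every morphism e in E is a λ-directed colimit, computed in the arrow category K^→, of morphisms of E whose domain and codomain are λ-generated w.r.t. M. -/

import Mathlib

open CategoryTheory CategoryTheory.Limits Opposite

universe w v u u₂

namespace LocallyGen

variable {K : Type u} [Category.{v} K]

/-- `m` has the unique right lifting property w.r.t. `e`
(every commutative square has a unique diagonal filler). -/
def UniqueLift {A B X Y : K} (e : A ⟶ B) (m : X ⟶ Y) : Prop :=
  ∀ (u : A ⟶ X) (v : B ⟶ Y), u ≫ m = e ≫ v →
    ∃! d : B ⟶ X, e ≫ d = u ∧ d ≫ m = v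

/-- An (orthogonal) factorization system `(E, M)` on `K`: both classes contain all
isomorphisms and are closed under composition, every morphism factors as an `E`-morphism
followed by an `M`-morphism, and `E` is orthogonal to `M`. -/
structure FactorizationSystem (K : Type u) [Category.{v} K] where
  E : MorphismProperty K
  M : MorphismProperty K
  E_iso : ∀ {A B : K} (f : A ⟶ B), IsIso f → E f
  M_iso : ∀ {A B : K} (f : A ⟶ B), IsIso f → M f
  E_comp : ∀ {A B C : K} (f : A ⟶ B) (g : B ⟶ C), E f → E g → E (f ≫ g)
  M_comp : ∀ {A B C : K} (f : A ⟶ B) (g : B ⟶ C), M f → M g → M (f ≫ g)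
  factor : ∀ {A B : K} (f : A ⟶ B), ∃ (C : K) (e : A ⟶ C) (m : C ⟶ B), E e ∧ M m ∧ e ≫ m = f
  orth : ∀ {A B X Y : K} (e : A ⟶ B) (m : X ⟶ Y), E e → M m → UniqueLift e m

/-- A preorder is `κ`-directed if every subset of cardinality `< κ` has an upper bound. -/
def CardinalDirected (I : Type w) [Preorder I] (κ : Cardinal.{w}) : Prop :=
  ∀ S : Set I, Cardinal.mk S < κ → ∃ i : I, ∀ j ∈ S, j ≤ i

/-- All connecting morphisms of a diagram indexed by a preorder lie in `M`. -/
def DiagramInM (M : MorphismProperty K) {I : Type w} [Preorder I] (D : I ⥤ K) : Prop :=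
  ∀ ⦃i j : I⦄ (h : i ≤ j), M (D.map (homOfLE h))

/-- `A` is `κ`-generated w.r.t. `M`: the hom-functor `K(A, -) : K ⥤ Type` preserves
`κ`-directed colimits of `M`-morphisms. -/
def IsGenerated (M : MorphismProperty K) (κ : Cardinal.{v}) (A : K) : Prop :=
  ∀ (I : Type v) [Preorder I], CardinalDirected I κ →
    ∀ (D : I ⥤ K), DiagramInM M D →
      ∀ (c : Cocone D), IsColimit c →
        Nonempty (IsColimit ((coyoneda.obj (op A)).mapCocone c))

/-- A small category is `κ`-small if it has fewer than `κ` morphisms. -/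
def IsCardinalSmall (J : Type w) [SmallCategory J] (κ : Cardinal.{w}) : Prop :=
  Cardinal.mk (Σ (a : J) (b : J), a ⟶ b) < κ

/-- Two `E`-quotients of `A` are isomorphic as quotients. -/
def QuotientRel (E : MorphismProperty K) (A : K)
    (p q : Σ B : K, {e : A ⟶ B // E e}) : Prop :=
  ∃ i : p.1 ≅ q.1, p.2.1 ≫ i.hom = q.2.1

/-- The factorization system `(E, M)` is `κ`-convenient: `K` is `E`-cowellpowered and
`M` is closed under `κ`-directed colimits. -/
structure Convenient (F : FactorizationSystem K) (κ : Cardinal.{v}) : Prop where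
  cowellpowered : ∀ A : K, Small.{v} (Quot (QuotientRel F.E A))
  M_cocone : ∀ (I : Type v) [Preorder I], CardinalDirected I κ →
      ∀ (D : I ⥤ K), DiagramInM F.M D → ∀ (c : Cocone D), IsColimit c →
        ∀ i : I, F.M (c.ι.app i)
  M_desc : ∀ (I : Type v) [Preorder I], CardinalDirected I κ →
      ∀ (D : I ⥤ K), DiagramInM F.M D → ∀ (c : Cocone D) (hc : IsColimit c)
        (c' : Cocone D), (∀ i : I, F.M (c'.ι.app i)) → F.M (hc.desc c')

/-- A presentation of `X` as a `κ`-directed colimit of objects from `S`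
and morphisms from `M`. -/
structure DirectedColimitPresentation (M : MorphismProperty K) (κ : Cardinal.{v})
    (S : Set K) (X : K) where
  I : Type v
  [instI : Preorder I]
  directed : CardinalDirected I κ
  D : I ⥤ K
  mem : ∀ i : I, D.obj i ∈ S
  inM : DiagramInM M D
  c : Cocone D
  pt_eq : c.pt = X
  isColimit : IsColimit c

/-- `K` is `M`-locally `κ`-generated, with witnessing set (of objects) `S`:
`K` is cocomplete, `(E, M)` is `κ`-convenient, `S` is a set of `κ`-generated objects
w.r.t. `M`, and every object of `K` is a `κ`-directed colimit of objects from `S`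
and morphisms from `M`. -/
structure IsLocallyGenerated (F : FactorizationSystem K) (κ : Cardinal.{v})
    (S : Set K) : Prop where
  hasColimits : HasColimits K
  convenient : Convenient F κ
  small : Small.{v} S
  gen : ∀ A ∈ S, IsGenerated F.M κ A
  presentation : ∀ X : K, Nonempty (DirectedColimitPresentation F.M κ S X)

/-- `K` is locally `κ`-presentable: cocomplete with a set `S` of `κ`-presentable objects
such that every object is a `κ`-directed colimit of objects from `S`. -/
def LocallyPresentable (K : Type u) [Category.{v} K] (κ : Cardinal.{v}) : Prop :=
  HasColimits K ∧ ∃ S : Set K, Small.{v} S ∧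
    (∀ A ∈ S, IsGenerated (⊤ : MorphismProperty K) κ A) ∧
    ∀ X : K, Nonempty (DirectedColimitPresentation (⊤ : MorphismProperty K) κ S X)


/-- A presentation of a morphism `e` as a `κ`-directed colimit, in the arrow category,
of `E`-morphisms with λ-generated domain and codomain. -/
structure ArrowColimitPresentation (F : FactorizationSystem K) (κ : Cardinal.{v})
    {A B : K} (e : A ⟶ B) where
  I : Type v
  [instI : Preorder I]
  directed : CardinalDirected I κ
  D : I ⥤ Arrow K
  objE : ∀ i : I, F.E (D.obj i).hom
  genLeft : ∀ i : I, IsGenerated F.M κ (D.obj i).left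
  genRight : ∀ i : I, IsGenerated F.M κ (D.obj i).right
  c : Cocone D
  pt_eq : c.pt = Arrow.mk e
  isColimit : IsColimit c

theorem M_cancel (F : FactorizationSystem K) {X Y Z : K} (f : X ⟶ Y) (g : Y ⟶ Z)
    (hg : F.M g) (hfg : F.M (f ≫ g)) : F.M f := by
  obtain ⟨C, e, m, he, hm, rfl⟩ := F.factor f
  obtain ⟨d, ⟨hd1, hd2⟩, -⟩ := F.orth e _ he hfg (𝟙 X) (m ≫ g) (by simp)
  have hde : d ≫ e = 𝟙 C := by
    refine (F.orth e _ he (F.M_comp m g hm hg) e (m ≫ g) rfl).unique ⟨?_, ?_⟩ ⟨?_, ?_⟩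
    · rw [← Category.assoc, hd1, Category.id_comp]
    · simpa using hd2
    · simp
    · simp
  exact F.M_comp e m (F.M_iso e ⟨d, hd1, hde⟩) hm

theorem CardinalDirected.isFiltered {I : Type v} [Preorder I] {κ : Cardinal.{v}}
    (hκ : κ.IsRegular) (hI : CardinalDirected I κ) : IsFiltered I := by
  have hne : Nonempty I := by
    obtain ⟨i, -⟩ := hI ∅ (by simpa using hκ.pos)
    exact ⟨i⟩
  have hdir : IsDirectedOrder I := ⟨fun a b => by
    obtain ⟨i, hi⟩ := hI {a, b}
      (lt_of_lt_of_le (Cardinal.lt_aleph0_of_finite _) hκ.aleph0_le)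
    exact ⟨i, hi a (by simp), hi b (by simp)⟩⟩
  infer_instance

theorem generated_quotient (F : FactorizationSystem K) (κ : Cardinal.{v}) (hκ : κ.IsRegular)
    (hF : Convenient F κ) {A B : K} (e : A ⟶ B) (he : F.E e) (hA : IsGenerated F.M κ A) :
    IsGenerated F.M κ B := by
  intro I _ hI D hD c hc
  have := hI.isFiltered hκ
  obtain ⟨hA⟩ := hA I hI D hD c hc
  have hM := hF.M_cocone I hI D hD c hc
  refine ⟨Types.FilteredColimit.isColimitOf _ _ ?_ ?_⟩
  · intro (x : B ⟶ c.pt)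
    obtain ⟨i, (y : A ⟶ D.obj i), hy⟩ := Types.jointly_surjective _ hA (e ≫ x)
    have hy : y ≫ c.ι.app i = e ≫ x := hy
    obtain ⟨d, ⟨-, hd⟩, -⟩ := F.orth e _ he (hM i) y x hy
    exact ⟨i, d, hd.symm⟩
  · intro i j (x : B ⟶ D.obj i) (y : B ⟶ D.obj j) hxy
    have hxy : x ≫ c.ι.app i = y ≫ c.ι.app j := hxy
    obtain ⟨k, f, g, hk⟩ := (Types.FilteredColimit.isColimit_eq_iff _ hA
      (xi := (e ≫ x : A ⟶ D.obj i)) (xj := (e ≫ y : A ⟶ D.obj j))).1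
      (show (e ≫ x) ≫ c.ι.app i = (e ≫ y) ≫ c.ι.app j by simp [hxy])
    have hk : (e ≫ x) ≫ D.map f = (e ≫ y) ≫ D.map g := hk
    refine ⟨k, f, g, ?_⟩
    show x ≫ D.map f = y ≫ D.map g
    refine (F.orth e _ he (hM k) ((e ≫ x) ≫ D.map f) (x ≫ c.ι.app i) (by simp)).unique
      ⟨by simp, by simp⟩ ⟨by simp [hk], by simp [hxy]⟩

/-- In an `M`-locally λ-generated category, every `E`-morphism is a
λ-directed colimit in the arrow category `K^→` of `E`-morphisms between λ-generated
objects w.r.t. `M`. -/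
theorem E_is_directed_colimit_of_small_E_morphisms
    (F : FactorizationSystem K) (κ : Cardinal.{v}) (hκ : κ.IsRegular)
    (S : Set K) (h : IsLocallyGenerated F κ S)
    {A B : K} (e : A ⟶ B) (he : F.E e) :
    Nonempty (ArrowColimitPresentation F κ e) := by
  obtain ⟨⟨I, hI, D, hS, hD, c, rfl, hc⟩⟩ := h.presentation A
  have := h.hasColimits
  have hF := h.convenient
  choose Q q m hq hm hqm using fun i => F.factor (c.ι.app i ≫ e)
  have key : ∀ {i j : I} (f : i ⟶ j), ∃! d : Q i ⟶ Q j, q i ≫ d = D.map f ≫ q j ∧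
      d ≫ m j = m i := fun {i j} f =>
    F.orth (q i) (m j) (hq i) (hm j) (D.map f ≫ q j) (m i) (by
      rw [Category.assoc, hqm, hqm, ← Category.assoc, c.w])
  choose d hd using fun {i j : I} (f : i ⟶ j) => (key f).exists
  let QD : I ⥤ K :=
    { obj := Q
      map := fun f => d f
      map_id := fun i => (key (𝟙 i)).unique (hd _) ⟨by simp, by simp⟩
      map_comp := fun {i j k} f g => (key (f ≫ g)).unique (hd _)
        ⟨by rw [← Category.assoc, (hd f).1, Category.assoc, (hd g).1]; simp,
          by rw [Category.assoc, (hd g).2, (hd f).2]⟩ }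
  have hQD : DiagramInM F.M QD := fun i j hij =>
    M_cancel F (d (homOfLE hij)) (m j) (hm j) (by rw [(hd _).2]; exact hm i)
  let cB : Cocone QD :=
    { pt := B
      ι := { app := m, naturality := fun i j f => by simpa [QD] using (hd f).2 } }
  let b : ∀ i, Q i ⟶ colimit QD := fun i => colimit.ι QD i
  have hb : ∀ {i j : I} (f : i ⟶ j), d f ≫ b j = b i := fun f => colimit.w QD f
  let m' : colimit QD ⟶ B := colimit.desc QD cB
  have hbm : ∀ i, b i ≫ m' = m i := fun i => colimit.ι_desc cB i
  have hm' : F.M m' := hF.M_desc I hI QD hQD _ (colimit.isColimit QD) cB hm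
  let cA : Cocone D :=
    { pt := colimit QD
      ι := { app := fun i => q i ≫ b i
             naturality := fun i j f => by
              simp only [Functor.const_obj_obj, Functor.const_obj_map, Category.comp_id]
              rw [← Category.assoc, ← (hd f).1, Category.assoc, hb] } }
  let e' : c.pt ⟶ colimit QD := hc.desc cA
  have hce' : ∀ i, c.ι.app i ≫ e' = q i ≫ b i := fun i => hc.fac cA i
  have hem : e' ≫ m' = e := hc.hom_ext fun i => by
    rw [← Category.assoc, hce', Category.assoc, hbm, hqm]
  obtain ⟨t, ⟨ht1, ht2⟩, -⟩ := F.orth e m' he hm' e' (𝟙 B) (by simp [hem])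
  have hmt : ∀ i, m i ≫ t = b i := fun i => by
    refine (F.orth (q i) m' (hq i) hm' (q i ≫ b i) (m i)
      (by rw [Category.assoc, hbm])).unique ⟨?_, ?_⟩ ⟨rfl, hbm i⟩
    · rw [← Category.assoc, hqm, Category.assoc, ht1, hce']
    · rw [Category.assoc, ht2, Category.comp_id]
  have hmt' : m' ≫ t = 𝟙 _ := colimit.hom_ext fun i => by
    change b i ≫ m' ≫ t = b i ≫ 𝟙 _
    rw [← Category.assoc, hbm, hmt, Category.comp_id]
  have hcB : IsColimit cB := (colimit.isColimit QD).ofIsoColimit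
    (Cocone.ext ⟨m', t, hmt', ht2⟩ hbm)
  let DA : I ⥤ Arrow K :=
    { obj := fun i => Arrow.mk (q i)
      map := fun {i j} f => Arrow.homMk (D.map f) (d f) (hd f).1.symm
      map_id := fun i => by ext <;> simp; exact QD.map_id i
      map_comp := fun f g => by ext <;> simp; exact QD.map_comp f g }
  let cc : Cocone DA :=
    { pt := Arrow.mk e
      ι := { app := fun i => Arrow.homMk (c.ι.app i) (m i) (hqm i).symm
             naturality := fun i j f => by
              ext
              · exact c.ι.naturality f
              · exact cB.ι.naturality f } }
  let sl : Cocone DA → Cocone D := fun s => Arrow.leftFunc.mapCocone s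
  let sr : Cocone DA → Cocone QD := fun s => Arrow.rightFunc.mapCocone s
  refine ⟨⟨I, hI, DA, hq, fun i => h.gen _ (hS i), fun i =>
    generated_quotient F κ hκ hF (q i) (hq i) (h.gen _ (hS i)), cc, rfl, ?_⟩⟩
  exact
    { desc := fun s => Arrow.homMk (hc.desc (sl s)) (hcB.desc (sr s)) (hc.hom_ext fun i => by
        have h1 : c.ι.app i ≫ hc.desc (sl s) = (s.ι.app i).left := hc.fac (sl s) i
        have h2 : m i ≫ hcB.desc (sr s) = (s.ι.app i).right := hcB.fac (sr s) i
        have h3 : (s.ι.app i).left ≫ s.pt.hom = q i ≫ (s.ι.app i).right := (s.ι.app i).w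
        change c.ι.app i ≫ hc.desc (sl s) ≫ s.pt.hom = c.ι.app i ≫ e ≫ hcB.desc (sr s)
        have e1 := (Category.assoc (c.ι.app i) (hc.desc (sl s)) s.pt.hom).symm
        have e2 := congrArg (fun z : D.obj i ⟶ s.pt.left => z ≫ s.pt.hom) h1
        have e3 := congrArg (fun z : Q i ⟶ s.pt.right => q i ≫ z) h2.symm
        have e4 := (Category.assoc (q i) (m i) (hcB.desc (sr s))).symm
        have e5 := congrArg (fun z : D.obj i ⟶ B => z ≫ hcB.desc (sr s)) (hqm i)
        have e6 := Category.assoc (c.ι.app i) e (hcB.desc (sr s))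
        exact e1.trans (e2.trans (h3.trans (e3.trans (e4.trans (e5.trans e6))))))
      fac := fun s i => by
        ext
        · exact hc.fac (sl s) i
        · exact hcB.fac (sr s) i
      uniq := fun s f hf => by
        ext
        · exact hc.uniq (sl s) f.left fun i => congrArg CommaMorphism.left (hf i)
        · exact hcB.uniq (sr s) f.right fun i => congrArg CommaMorphism.right (hf i) }

end LocallyGen
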